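/- Let λ be a partition with at most 2 parts and let p be a prime with p > max{2, s_λ} that does not divide Δ(n_λ). Suppose the reduction of He_λ(x) modulo p equals x^t · Q̄(x) for some integer t ≥ 0 and some polynomial Q̄ over ℤ/pℤ of degree D with Q̄(0) ≠ 0. Then R_λ(x) has no factor of degree d in ℤ[x] for any d with D + 1 ≤ d ≤ p − s_λ − 1. -/

import Mathlib

open Polynomial Finset

/-- Probabilists' Hermite polynomials over `ℤ`:
`He 0 = 1`, `He 1 = X`, `He (n+1) = X * He n - n * He (n-1)`. -/
noncomputable def He : ℕ → Polynomial ℤ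
  | 0 => 1
  | 1 => Polynomial.X
  | n + 2 => Polynomial.X * He (n + 1) - Polynomial.C ((n : ℤ) + 1) * He n

/-- The Wronskian `Wr[He_{n_1}, …, He_{n_r}]` of the Hermite polynomials indexed by
a degree sequence `ns : Fin r → ℕ`; entry `(i,j)` is the `i`-th derivative of `He (ns j)`. -/
noncomputable def wronskHe {r : ℕ} (ns : Fin r → ℕ) : Polynomial ℤ :=
  Matrix.det (Matrix.of fun i j : Fin r =>
    (fun q : Polynomial ℤ => Polynomial.derivative q)^[(i : ℕ)] (He (ns j)))

/-- `Δ(n_λ) = ∏_{i<j} (n_j - n_i)`. -/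
def vand {r : ℕ} (ns : Fin r → ℕ) : ℤ :=
  ∏ j : Fin r, ∏ i ∈ Finset.Iio j, ((ns j : ℤ) - (ns i : ℤ))

/-- The degree sequence `n_λ` of a partition `λ = (λ_1 ≥ … ≥ λ_r)`,
`n_i = λ_{r+1-i} + (i-1)` (indices shifted to start at `0`). -/
def degSeq {r : ℕ} (lam : Fin r → ℕ) : Fin r → ℕ :=
  fun i => lam i.rev + (i : ℕ)

/-- `d_λ` = (number of odd entries of the degree sequence) − (number of even entries). -/
def dStat {r : ℕ} (ns : Fin r → ℕ) : ℤ :=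
  ((Finset.univ.filter fun i => Odd (ns i)).card : ℤ) -
    ((Finset.univ.filter fun i => Even (ns i)).card : ℤ)

/-- `s_λ = d_λ(d_λ+1)/2`, the size of the 2-core of `λ`. -/
def sStat {r : ℕ} (ns : Fin r → ℕ) : ℕ :=
  (dStat ns * (dStat ns + 1) / 2).toNat

lemma derivative_He_succ (n : ℕ) :
    derivative (He (n + 1)) = C ((n : ℤ) + 1) * He n := by
  induction n using Nat.strong_induction_on with
  | _ n ih =>
    match n with
    | 0 => simp [He]
    | 1 => simp [He]; ring
    | n + 2 =>
      have h1 := ih (n + 1) (by omega)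
      have h0 := ih n (by omega)
      rw [He, derivative_sub, derivative_mul, derivative_mul, h1, h0, derivative_X, derivative_C]
      have e : He (n + 2) = X * He (n + 1) - C ((n : ℤ) + 1) * He n := by rw [He]
      rw [e]
      push_cast
      simp only [map_add, map_one, map_natCast, map_ofNat]
      ring

/-- The Hermite differential equation. -/
lemma He_diff_eq (n : ℕ) :
    derivative (derivative (He n)) - X * derivative (He n) + C (n : ℤ) * He n = 0 := by
  match n with
  | 0 => simp [He]
  | 1 => simp [He]
  | n + 2 =>
    rw [derivative_He_succ (n + 1), derivative_C_mul, derivative_He_succ n, He]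
    push_cast
    simp only [map_add, map_one, map_natCast, map_ofNat]
    ring

lemma He_coeff_rec (n k : ℕ) :
    (He n).coeff (k + 2) * ((k + 2) * (k + 1)) = ((k : ℤ) - n) * (He n).coeff k := by
  have h := congrArg (fun q => q.coeff k) (He_diff_eq n)
  simp only [coeff_add, coeff_sub, coeff_C_mul, coeff_zero, coeff_derivative] at h
  have h2 : (X * derivative (He n)).coeff k = (k : ℤ) * (He n).coeff k := by
    cases k with
    | zero => simp
    | succ k => rw [coeff_X_mul, coeff_derivative]; push_cast; ring
  rw [h2] at h
  push_cast at h
  linarith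

lemma He_monic_natDegree (n : ℕ) : (He n).Monic ∧ (He n).natDegree = n := by
  induction n using Nat.strong_induction_on with
  | _ n ih =>
    match n with
    | 0 => simp [He]
    | 1 => simp [He, monic_X]
    | n + 2 =>
      obtain ⟨m1, d1⟩ := ih (n + 1) (by omega)
      obtain ⟨m0, d0⟩ := ih n (by omega)
      have hm : (X * He (n + 1)).Monic := monic_X.mul m1
      have hd : (X * He (n + 1)).natDegree = n + 2 := by
        rw [monic_X.natDegree_mul m1, natDegree_X, d1]; ring
      have hlt : (C ((n : ℤ) + 1) * He n).natDegree < (X * He (n + 1)).natDegree := by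
        rw [hd]
        refine (natDegree_C_mul_le _ _).trans_lt ?_
        omega
      rw [He]
      exact ⟨hm.sub_of_left (degree_lt_degree hlt),
        by rw [natDegree_sub_eq_left_of_natDegree_lt hlt, hd]⟩

lemma He_coeff_self (n : ℕ) : (He n).coeff n = 1 := by
  obtain ⟨hm, hd⟩ := He_monic_natDegree n
  have h := hm.coeff_natDegree
  rwa [hd] at h

lemma He_coeff_of_odd_add (n k : ℕ) (h : Odd (n + k)) : (He n).coeff k = 0 := by
  induction n using Nat.strong_induction_on generalizing k with
  | _ n ih =>
    match n with
    | 0 =>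
      have : k ≠ 0 := by rintro rfl; simp at h
      simp [He, coeff_one, this]
    | 1 =>
      have : k ≠ 1 := by rintro rfl; simp +decide at h
      simp [He, coeff_X, this.symm]
    | n + 2 =>
      rw [He, coeff_sub, coeff_C_mul, ih n (by omega) k (by grind)]
      cases k with
      | zero => simp
      | succ k => rw [coeff_X_mul, ih (n + 1) (by omega) k (by grind)]; simp

lemma He_even_coeff (M j : ℕ) : (He (2 * M)).coeff (2 * j) * ((2 * j - 1).doubleFactorial : ℤ) =
    (-1) ^ j * (M.choose j : ℤ) * (He (2 * M)).coeff 0 := by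
  induction j with
  | zero => simp
  | succ j ih =>
    have h := He_coeff_rec (2 * M) (2 * j)
    have hd : ((2 * (j + 1) - 1).doubleFactorial : ℤ) =
        (2 * j + 1) * ((2 * j - 1).doubleFactorial : ℤ) := by
      have := Nat.doubleFactorial_add_one (2 * j)
      rw [show 2 * (j + 1) - 1 = 2 * j + 1 by omega, this]; push_cast; ring
    have hc : (M.choose (j + 1) : ℤ) * (j + 1) = M.choose j * ((M : ℤ) - j) := by
      rcases le_or_gt j M with hj | hj
      · have := Nat.choose_succ_right_eq M j
        zify [hj] at this; exact this
      · simp [Nat.choose_eq_zero_of_lt hj, Nat.choose_eq_zero_of_lt (show M < j + 1 by omega)]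
    have hne : (2 * (j : ℤ) + 2) ≠ 0 := by positivity
    apply mul_right_cancel₀ hne
    rw [hd, show 2 * (j + 1) = 2 * j + 2 by ring]
    push_cast at h
    linear_combination ((2 * j - 1).doubleFactorial : ℤ) * h + (2 * (j : ℤ) - 2 * M) * ih
      + 2 * (-1) ^ j * (He (2 * M)).coeff 0 * hc

lemma He_odd_coeff (M j : ℕ) :
    (He (2 * M + 1)).coeff (2 * j + 1) * ((2 * j + 1).doubleFactorial : ℤ) =
      (-1) ^ j * (M.choose j : ℤ) * (He (2 * M + 1)).coeff 1 := by
  induction j with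
  | zero => simp
  | succ j ih =>
    have h := He_coeff_rec (2 * M + 1) (2 * j + 1)
    have hd : ((2 * (j + 1) + 1).doubleFactorial : ℤ) =
        (2 * j + 3) * ((2 * j + 1).doubleFactorial : ℤ) := by
      have := Nat.doubleFactorial_add_two (2 * j + 1)
      rw [show 2 * (j + 1) + 1 = 2 * j + 1 + 2 by omega, this]; push_cast; ring
    have hc : (M.choose (j + 1) : ℤ) * (j + 1) = M.choose j * ((M : ℤ) - j) := by
      rcases le_or_gt j M with hj | hj
      · have := Nat.choose_succ_right_eq M j
        zify [hj] at this; exact this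
      · simp [Nat.choose_eq_zero_of_lt hj, Nat.choose_eq_zero_of_lt (show M < j + 1 by omega)]
    have hne : (2 * (j : ℤ) + 2) ≠ 0 := by positivity
    apply mul_right_cancel₀ hne
    rw [hd, show 2 * (j + 1) + 1 = 2 * j + 1 + 2 by ring]
    push_cast at h
    linear_combination ((2 * j + 1).doubleFactorial : ℤ) * h + (2 * (j : ℤ) - 2 * M) * ih
      + 2 * (-1) ^ j * (He (2 * M + 1)).coeff 1 * hc

lemma He_even_coeff_zero_ne (M : ℕ) : (He (2 * M)).coeff 0 ≠ 0 := by
  intro h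
  have h1 := He_even_coeff M M
  rw [He_coeff_self, h] at h1
  simp [(Nat.doubleFactorial_pos _).ne'] at h1

lemma He_odd_coeff_one_ne (M : ℕ) : (He (2 * M + 1)).coeff 1 ≠ 0 := by
  intro h
  have h1 := He_odd_coeff M M
  rw [He_coeff_self, h] at h1
  simp [(Nat.doubleFactorial_pos _).ne'] at h1

section padic

variable {p : ℕ} [hp : Fact p.Prime]

lemma norm_natCast_eq_inv_pow {n : ℕ} (hn : n ≠ 0) :
    ‖(n : ℚ_[p])‖ = ((p : ℝ) ^ padicValNat p n)⁻¹ := by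
  rw [Padic.norm_eq_zpow_neg_valuation (by exact_mod_cast hn), Padic.valuation_natCast]
  simp

lemma norm_le_of_dvd_factorial {q n : ℕ} (hn : n ∣ (2 * q + 1).factorial) {x y : ℤ}
    {u : ℤ} (h : x * (n : ℤ) = u * y) :
    ∃ e : ℕ, (p - 1) * e ≤ 2 * q ∧ ‖(x : ℚ_[p])‖ ≤ ‖(y : ℚ_[p])‖ * (p : ℝ) ^ e := by
  have hf := Nat.factorial_ne_zero (2 * q + 1)
  refine ⟨padicValNat p (2 * q + 1).factorial, ?_, ?_⟩
  · have := sub_one_mul_padicValNat_factorial_lt_of_ne_zero p (n := 2 * q + 1) (by omega)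
    omega
  · obtain ⟨w, hw⟩ := hn
    have hp0 : (0 : ℝ) < p := by exact_mod_cast hp.out.pos
    have h1 : x * ((2 * q + 1).factorial : ℤ) = (u * w) * y := by
      rw [hw]; push_cast; linear_combination (w : ℤ) * h
    have h2 := congrArg (fun z : ℤ => ‖(z : ℚ_[p])‖) h1
    simp only [Int.cast_mul, Int.cast_natCast] at h2
    rw [norm_mul, norm_mul, norm_natCast_eq_inv_pow hf] at h2
    have h3 : ‖(u : ℚ_[p]) * (w : ℚ_[p])‖ ≤ 1 := by
      have := Padic.norm_int_le_one (p := p) (u * w)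
      exact_mod_cast this
    rw [← div_eq_mul_inv, div_eq_iff (by positivity)] at h2
    rw [h2]
    gcongr
    exact mul_le_of_le_one_left (norm_nonneg _) h3

lemma doubleFactorial_dvd_factorial (n : ℕ) : n.doubleFactorial ∣ n.factorial := by
  cases n with
  | zero => simp
  | succ n => exact ⟨_, Nat.factorial_eq_mul_doubleFactorial n⟩

lemma doubleFactorial_dvd_factorial_pred (j : ℕ) :
    (2 * j - 1).doubleFactorial ∣ (2 * (j - 1) + 1).factorial := by
  cases j with
  | zero => simp
  | succ j => exact doubleFactorial_dvd_factorial _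

lemma norm_He_even_le (M j : ℕ) : ∃ e : ℕ, (p - 1) * e ≤ 2 * (j - 1) ∧
    ‖((He (2 * M)).coeff (2 * j) : ℚ_[p])‖ ≤ ‖((He (2 * M)).coeff 0 : ℚ_[p])‖ * (p : ℝ) ^ e :=
  norm_le_of_dvd_factorial (doubleFactorial_dvd_factorial_pred j) (He_even_coeff M j)

lemma norm_He_odd_le (M j : ℕ) : ∃ e : ℕ, (p - 1) * e ≤ 2 * j ∧
    ‖((He (2 * M + 1)).coeff (2 * j + 1) : ℚ_[p])‖ ≤
      ‖((He (2 * M + 1)).coeff 1 : ℚ_[p])‖ * (p : ℝ) ^ e :=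
  norm_le_of_dvd_factorial (doubleFactorial_dvd_factorial _) (He_odd_coeff M j)

lemma norm_mul_He_odd_le (M j : ℕ) : ∃ e : ℕ, (p - 1) * e ≤ 2 * (j - 1) ∧
    ‖(((2 * j + 1 : ℕ) * (He (2 * M + 1)).coeff (2 * j + 1) : ℤ) : ℚ_[p])‖ ≤
      ‖((He (2 * M + 1)).coeff 1 : ℚ_[p])‖ * (p : ℝ) ^ e := by
  refine norm_le_of_dvd_factorial (doubleFactorial_dvd_factorial_pred j)
    (u := (-1) ^ j * (M.choose j : ℤ)) ?_
  rw [← He_odd_coeff M j, Nat.doubleFactorial_add_one (2 * j)]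
  push_cast
  ring

end padic

lemma norm_sum_lt_of_forall_lt {ι E : Type*} [NormedAddCommGroup E] [IsUltrametricDist E]
    {t : Finset ι} {f : ι → E} {c : ℝ} (hc : 0 < c) (h : ∀ i ∈ t, ‖f i‖ < c) :
    ‖∑ i ∈ t, f i‖ < c := by
  rcases t.eq_empty_or_nonempty with rfl | ht
  · simpa
  · obtain ⟨i, hi, hle⟩ := IsUltrametricDist.exists_norm_finsetSum_le_of_nonempty ht f
    exact hle.trans_lt (h i hi)

/-- If the constant term of `g * h` strictly dominates all other terms on the circle of radius
`r` (for a nonarchimedean absolute value), then so does the constant term of `g`. -/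
lemma norm_coeff_mul_pow_lt_of_mul {K : Type*} [NormedField K] [IsUltrametricDist K]
    {g h : K[X]} {r : ℝ} (hr : 0 < r)
    (H : ∀ k, 1 ≤ k → ‖(g * h).coeff k‖ * r ^ k < ‖(g * h).coeff 0‖) :
    ∀ k, 1 ≤ k → ‖g.coeff k‖ * r ^ k < ‖g.coeff 0‖ := by
  have max_exists : ∀ f : K[X], ∃ k, (∀ i, ‖f.coeff i‖ * r ^ i ≤ ‖f.coeff k‖ * r ^ k) ∧
      ∀ i, k < i → f ≠ 0 → ‖f.coeff i‖ * r ^ i < ‖f.coeff k‖ * r ^ k := by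
    intro f
    obtain ⟨k, -, hk⟩ := Finset.exists_max_image (Finset.range (f.natDegree + 1))
      (fun i => toLex (‖f.coeff i‖ * r ^ i, i)) ⟨0, by simp⟩
    have key : ∀ i, i ≤ f.natDegree → ‖f.coeff i‖ * r ^ i < ‖f.coeff k‖ * r ^ k ∨
        ‖f.coeff i‖ * r ^ i = ‖f.coeff k‖ * r ^ k ∧ i ≤ k := by
      intro i hi
      have := hk i (by simp; omega)
      rwa [Prod.Lex.toLex_le_toLex] at this
    have hnn : 0 ≤ ‖f.coeff k‖ * r ^ k := by positivity
    have hz : ∀ i, f.natDegree < i → ‖f.coeff i‖ * r ^ i = 0 := fun i hi => by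
      simp [coeff_eq_zero_of_natDegree_lt hi]
    refine ⟨k, fun i => ?_, fun i hi hf => ?_⟩
    · rcases le_or_gt i f.natDegree with h | h
      · rcases key i h with h | h
        exacts [h.le, h.1.le]
      · rw [hz i h]; exact hnn
    · rcases le_or_gt i f.natDegree with h | h
      · rcases key i h with h | h
        · exact h
        · omega
      · rw [hz i h]
        have hlead : 0 < ‖f.coeff f.natDegree‖ * r ^ f.natDegree := by
          have : f.coeff f.natDegree ≠ 0 := by simpa using hf
          positivity
        rcases key f.natDegree le_rfl with h | h
        · exact hlead.trans h
        · exact h.1 ▸ hlead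
  have h0 : 0 < ‖(g * h).coeff 0‖ := lt_of_le_of_lt (by positivity) (H 1 le_rfl)
  rw [mul_coeff_zero, norm_mul] at h0
  have hg : g ≠ 0 := by rintro rfl; simp at h0
  have hh : h ≠ 0 := by rintro rfl; simp at h0
  obtain ⟨k, hk, hk'⟩ := max_exists g
  obtain ⟨l, hl, hl'⟩ := max_exists h
  have hg0 := hk 0
  have hh0 := hl 0
  simp only [pow_zero, mul_one] at hg0 hh0
  have hgpos : 0 < ‖g.coeff k‖ * r ^ k := 
    lt_of_lt_of_le (pos_of_mul_pos_left h0 (norm_nonneg _)) hg0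
  have hhpos : 0 < ‖h.coeff l‖ * r ^ l := 
    lt_of_lt_of_le (pos_of_mul_pos_right h0 (norm_nonneg _)) hh0
  have hsum : ‖(g * h).coeff (k + l)‖ = ‖g.coeff k * h.coeff l‖ := by
    rw [coeff_mul, ← Finset.add_sum_erase _ _ (a := (k, l)) (by simp)]
    have hrest : ‖∑ x ∈ (antidiagonal (k + l)).erase (k, l), g.coeff x.1 * h.coeff x.2‖ <
        ‖g.coeff k * h.coeff l‖ := by
      refine norm_sum_lt_of_forall_lt (norm_pos_iff.2 (mul_ne_zero ?_ ?_)) fun x hx => ?_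
      · rintro h; simp [h] at hgpos
      · rintro h; simp [h] at hhpos
      · obtain ⟨i, j⟩ := x
        simp only [mem_erase, ne_eq, Prod.mk.injEq,
          HasAntidiagonal.mem_antidiagonal] at hx
        have hcmp : (‖g.coeff i‖ * r ^ i) * (‖h.coeff j‖ * r ^ j) <
            (‖g.coeff k‖ * r ^ k) * (‖h.coeff l‖ * r ^ l) := by
          rcases lt_or_ge k i with hi | hi
          · exact (mul_le_mul_of_nonneg_left (hl j) (by positivity)).trans_lt
              (mul_lt_mul_of_pos_right (hk' i hi hg) hhpos)
          · exact mul_lt_mul' (hk i) (hl' j (by omega) hh) (by positivity) hgpos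
        have e1 : (‖g.coeff i‖ * r ^ i) * (‖h.coeff j‖ * r ^ j) =
            ‖g.coeff i * h.coeff j‖ * r ^ (k + l) := by
          rw [← hx.2, pow_add, norm_mul]; ring
        have e2 : (‖g.coeff k‖ * r ^ k) * (‖h.coeff l‖ * r ^ l) =
            ‖g.coeff k * h.coeff l‖ * r ^ (k + l) := by
          rw [pow_add, norm_mul]; ring
        rw [e1, e2] at hcmp
        exact lt_of_mul_lt_mul_right hcmp (by positivity)
    rw [IsUltrametricDist.norm_add_eq_max_of_norm_ne_norm hrest.ne', max_eq_left hrest.le]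
  have hkl : ‖g.coeff 0‖ * ‖h.coeff 0‖ ≤ ‖(g * h).coeff (k + l)‖ * r ^ (k + l) := by
    rw [hsum, norm_mul, pow_add]
    calc _ ≤ (‖g.coeff k‖ * r ^ k) * (‖h.coeff l‖ * r ^ l) := by gcongr
      _ = _ := by ring
  have hk0 : k = 0 := by
    by_contra hne
    have := H (k + l) (by omega)
    rw [mul_coeff_zero, norm_mul] at this
    linarith
  subst hk0
  intro i hi
  simpa using hk' i (by omega) hg

section dominant

variable {p : ℕ} [hp : Fact p.Prime]

variable (p) in
/-- The coefficient of `X ^ s` in `F` strictly dominates all higher ones, when `F` is divided by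
`X ^ s` and considered on the `p`-adic circle of radius `r`. -/
def IsDominant (r : ℝ) (s : ℕ) (F : ℤ[X]) : Prop :=
  ∀ k, 1 ≤ k → ‖(F.coeff (s + k) : ℚ_[p])‖ * r ^ k < ‖(F.coeff s : ℚ_[p])‖

lemma IsDominant.of_neg {r : ℝ} {s : ℕ} {F : ℤ[X]} (h : IsDominant p r s (-F)) :
    IsDominant p r s F := by
  intro k hk
  simpa using h k hk

lemma mul_pow_lt_of_le {r c x : ℝ} {d e k : ℕ} (hr : 0 < r) (hrd : r ^ d = (p : ℝ)⁻¹)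
    (hc : 0 < c) (hx : x ≤ c * (p : ℝ) ^ e) (h : d * e < k) : x * r ^ k < c := by
  have hp1 : (1 : ℝ) < p := by exact_mod_cast hp.out.one_lt
  have hr1 : r < 1 := by
    by_contra! h1
    have h2 := one_le_pow₀ h1 (n := d)
    rw [hrd] at h2
    exact absurd h2 (not_le.2 (inv_lt_one_of_one_lt₀ hp1))
  calc x * r ^ k ≤ c * (p : ℝ) ^ e * r ^ k := by gcongr
    _ < c * (p : ℝ) ^ e * r ^ (d * e) := by
      gcongr 1
      exact pow_lt_pow_right_of_lt_one₀ hr hr1 h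
    _ = c := by
      rw [pow_mul, hrd, inv_pow, mul_assoc, mul_inv_cancel₀ (by positivity), mul_one]

lemma norm_intCast_pos {z : ℤ} (hz : z ≠ 0) : 0 < ‖(z : ℚ_[p])‖ := by
  rw [norm_pos_iff]; exact_mod_cast hz

lemma isDominant_He_even {r : ℝ} {d : ℕ} (hr : 0 < r) (hrd : r ^ d = (p : ℝ)⁻¹)
    (hd : d + 1 ≤ p) (M : ℕ) : IsDominant p r 0 (He (2 * M)) := by
  intro k hk
  have hpos := norm_intCast_pos (p := p) (He_even_coeff_zero_ne M)
  rcases Nat.even_or_odd' k with ⟨j, rfl | rfl⟩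
  · obtain ⟨e, he, hle⟩ := norm_He_even_le (p := p) M j
    rw [zero_add]
    refine mul_pow_lt_of_le hr hrd hpos hle ?_
    have := Nat.mul_le_mul_right e (show d ≤ p - 1 by omega)
    omega
  · rw [He_coeff_of_odd_add _ _ (by grind)]
    simpa using hpos

lemma isDominant_He_odd {r : ℝ} {d : ℕ} (hr : 0 < r) (hrd : r ^ d = (p : ℝ)⁻¹)
    (hd : d + 2 ≤ p) (M : ℕ) : IsDominant p r 1 (He (2 * M + 1)) := by
  intro k hk
  have hpos := norm_intCast_pos (p := p) (He_odd_coeff_one_ne M)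
  rcases Nat.even_or_odd' k with ⟨j, rfl | rfl⟩
  · obtain ⟨e, he, hle⟩ := norm_He_odd_le (p := p) M j
    rw [add_comm 1]
    refine mul_pow_lt_of_le hr hrd hpos hle ?_
    have := Nat.mul_le_mul_right e (show d + 1 ≤ p - 1 by omega)
    rw [add_mul, one_mul] at this
    rcases Nat.eq_zero_or_pos e with rfl | h
    · omega
    · omega
  · rw [He_coeff_of_odd_add _ _ (by grind)]
    simpa using hpos

lemma coeff_wronskian (f g : ℤ[X]) (N : ℕ) :
    (f * derivative g - derivative f * g).coeff N =
      ∑ x ∈ Finset.HasAntidiagonal.antidiagonal (N + 1),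
        ((x.2 : ℤ) - x.1) * (f.coeff x.1 * g.coeff x.2) := by
  have hX : ∀ (q : ℤ[X]) i, (X * derivative q).coeff i = i * q.coeff i := by
    intro q i
    cases i with
    | zero => simp
    | succ i => rw [coeff_X_mul, coeff_derivative]; push_cast; ring
  rw [← coeff_X_mul, show X * (f * derivative g - derivative f * g) =
    f * (X * derivative g) - (X * derivative f) * g by ring, coeff_sub, coeff_mul, coeff_mul,
    ← Finset.sum_sub_distrib]
  refine Finset.sum_congr rfl fun x _ => ?_
  rw [hX, hX]; ring

lemma isDominant_wronskian {f g : ℤ[X]} {r c : ℝ} {s : ℕ} (hr : 0 < r) (hc : 0 < c)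
    (hs : ‖((f * derivative g - derivative f * g).coeff s : ℚ_[p])‖ = c)
    (h : ∀ i j k, 1 ≤ k → i + j = s + k + 1 →
      ‖((((j : ℤ) - i) * (f.coeff i * g.coeff j) : ℤ) : ℚ_[p])‖ * r ^ k < c) :
    IsDominant p r s (f * derivative g - derivative f * g) := by
  intro k hk
  rw [hs, coeff_wronskian, Int.cast_sum, ← lt_div_iff₀ (by positivity)]
  refine norm_sum_lt_of_forall_lt (by positivity) fun x hx => ?_
  rw [lt_div_iff₀ (by positivity)]
  exact h x.1 x.2 k hk (by simpa using hx)

lemma norm_index_sub_mul_le (i j : ℕ) {a b : ℤ} {x y : ℝ} (ha : ‖(a : ℚ_[p])‖ ≤ x)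
    (hb : ‖(b : ℚ_[p])‖ ≤ y) : ‖((((j : ℤ) - i) * (a * b) : ℤ) : ℚ_[p])‖ ≤ x * y := by
  rw [Int.cast_mul, Int.cast_mul, norm_mul, norm_mul]
  calc _ ≤ 1 * (x * y) := by
        have := (norm_nonneg _).trans ha
        gcongr
        exact Padic.norm_int_le_one _
    _ = _ := one_mul _

lemma isDominant_wronskian_even_even {r : ℝ} {d : ℕ} (hr : 0 < r) (hrd : r ^ d = (p : ℝ)⁻¹)
    (hd : d + 2 ≤ p) {A B : ℕ} (hAB : ¬ (p : ℤ) ∣ ((2 * B : ℕ) : ℤ) - ((2 * A : ℕ) : ℤ)) :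
    IsDominant p r 1
      (He (2 * A) * derivative (He (2 * B)) - derivative (He (2 * A)) * He (2 * B)) := by
  have ha := norm_intCast_pos (p := p) (He_even_coeff_zero_ne A)
  have hb := norm_intCast_pos (p := p) (He_even_coeff_zero_ne B)
  refine isDominant_wronskian hr (mul_pos ha hb) ?_ ?_
  · have h1 := He_coeff_rec (2 * A) 0
    have h2 := He_coeff_rec (2 * B) 0
    have h3 : (He (2 * A)).coeff 1 = 0 := He_coeff_of_odd_add _ _ (by grind)
    have hu := Padic.norm_intCast_eq_one_iff (p := p)
      (z := ((2 * B : ℕ) : ℤ) - ((2 * A : ℕ) : ℤ))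
    have hco := (((Nat.prime_iff_prime_int.1 hp.out).coprime_iff_not_dvd).2 hAB).symm
    have : (He (2 * A) * derivative (He (2 * B)) - derivative (He (2 * A)) * He (2 * B)).coeff 1 =
        -((((2 * B : ℕ) : ℤ) - ((2 * A : ℕ) : ℤ)) *
          ((He (2 * A)).coeff 0 * (He (2 * B)).coeff 0)) := by
      rw [coeff_wronskian]
      simp [Finset.Nat.antidiagonal_succ, h3] at h1 h2 ⊢
      linear_combination (He (2 * A)).coeff 0 * h2 - (He (2 * B)).coeff 0 * h1
    rw [this, Int.cast_neg, norm_neg, Int.cast_mul, norm_mul, hu.2 hco, one_mul, Int.cast_mul,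
      norm_mul]
  · intro i j k hk hij
    rcases Nat.even_or_odd' i with ⟨i, rfl | rfl⟩
    · rcases Nat.even_or_odd' j with ⟨j, rfl | rfl⟩
      · obtain ⟨e, he, hle⟩ := norm_He_even_le (p := p) A i
        obtain ⟨e', he', hle'⟩ := norm_He_even_le (p := p) B j
        have := norm_index_sub_mul_le (2 * i) (2 * j) hle hle'
        rw [mul_mul_mul_comm, ← pow_add] at this
        refine mul_pow_lt_of_le hr hrd (mul_pos ha hb) this ?_
        have h1 := Nat.mul_le_mul_right e (show d + 1 ≤ p - 1 by omega)
        have h2 := Nat.mul_le_mul_right e' (show d + 1 ≤ p - 1 by omega)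
        rw [add_mul, one_mul] at h1 h2
        rw [mul_add]
        rcases Nat.eq_zero_or_pos (e + e') with h | h
        · obtain ⟨rfl, rfl⟩ : e = 0 ∧ e' = 0 := by omega
          omega
        · omega
      · rw [He_coeff_of_odd_add (2 * B) _ (by grind)]
        simpa using mul_pos ha hb
    · rw [He_coeff_of_odd_add (2 * A) _ (by grind)]
      simpa using mul_pos ha hb

lemma isDominant_wronskian_odd_odd {r : ℝ} {d : ℕ} (hr : 0 < r) (hrd : r ^ d = (p : ℝ)⁻¹)
    (hd : d + 4 ≤ p) (hp3 : 3 < p) {A B : ℕ}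
    (hAB : ¬ (p : ℤ) ∣ ((2 * B + 1 : ℕ) : ℤ) - ((2 * A + 1 : ℕ) : ℤ)) :
    IsDominant p r 3 (He (2 * A + 1) * derivative (He (2 * B + 1)) -
      derivative (He (2 * A + 1)) * He (2 * B + 1)) := by
  have ha := norm_intCast_pos (p := p) (He_odd_coeff_one_ne A)
  have hb := norm_intCast_pos (p := p) (He_odd_coeff_one_ne B)
  refine isDominant_wronskian hr (mul_pos ha hb) ?_ ?_
  · have h1 := He_coeff_rec (2 * A + 1) 1
    have h2 := He_coeff_rec (2 * B + 1) 1
    have h3 : (He (2 * A + 1)).coeff 0 = 0 := He_coeff_of_odd_add _ _ (by grind)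
    have h4 : (He (2 * A + 1)).coeff 2 = 0 := He_coeff_of_odd_add _ _ (by grind)
    have h5 : (He (2 * B + 1)).coeff 0 = 0 := He_coeff_of_odd_add _ _ (by grind)
    have hu := Padic.norm_intCast_eq_one_iff (p := p)
      (z := ((2 * B + 1 : ℕ) : ℤ) - ((2 * A + 1 : ℕ) : ℤ))
    have hco := (((Nat.prime_iff_prime_int.1 hp.out).coprime_iff_not_dvd).2 hAB).symm
    have hn3 : ‖((3 : ℤ) : ℚ_[p])‖ = 1 := by
      rw [Padic.norm_intCast_eq_one_iff]
      refine (((Nat.prime_iff_prime_int.1 hp.out).coprime_iff_not_dvd).2 fun h => ?_).symm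
      have := Int.le_of_dvd (by norm_num) h
      omega
    have : 3 * (He (2 * A + 1) * derivative (He (2 * B + 1)) -
          derivative (He (2 * A + 1)) * He (2 * B + 1)).coeff 3 =
        -((((2 * B + 1 : ℕ) : ℤ) - ((2 * A + 1 : ℕ) : ℤ)) *
          ((He (2 * A + 1)).coeff 1 * (He (2 * B + 1)).coeff 1)) := by
      rw [coeff_wronskian]
      simp [Finset.Nat.antidiagonal_succ, h3, h4, h5] at h1 h2 ⊢
      linear_combination (He (2 * A + 1)).coeff 1 * h2 - (He (2 * B + 1)).coeff 1 * h1
    have h6 := congrArg (fun z : ℤ => ‖(z : ℚ_[p])‖) this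
    rw [Int.cast_neg, norm_neg, Int.cast_mul, norm_mul, Int.cast_mul, norm_mul, hu.2 hco, one_mul,
      hn3, one_mul, Int.cast_mul, norm_mul] at h6
    exact h6
  · intro i j k hk hij
    rcases Nat.even_or_odd' i with ⟨i, rfl | rfl⟩
    · rw [He_coeff_of_odd_add (2 * A + 1) _ (by grind)]
      simpa using mul_pos ha hb
    · rcases Nat.even_or_odd' j with ⟨j, rfl | rfl⟩
      · rw [He_coeff_of_odd_add (2 * B + 1) _ (by grind)]
        simpa using mul_pos ha hb
      · obtain ⟨e, he, hle⟩ := norm_He_odd_le (p := p) A i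
        obtain ⟨e', he', hle'⟩ := norm_He_odd_le (p := p) B j
        have := norm_index_sub_mul_le (2 * i + 1) (2 * j + 1) hle hle'
        rw [mul_mul_mul_comm, ← pow_add] at this
        refine mul_pow_lt_of_le hr hrd (mul_pos ha hb) this ?_
        have h1 := Nat.mul_le_mul_right e (show d + 3 ≤ p - 1 by omega)
        have h2 := Nat.mul_le_mul_right e' (show d + 3 ≤ p - 1 by omega)
        rw [add_mul] at h1 h2
        rw [mul_add]
        rcases Nat.eq_zero_or_pos (e + e') with h | h
        · obtain ⟨rfl, rfl⟩ : e = 0 ∧ e' = 0 := by omega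
          omega
        · omega

lemma isDominant_wronskian_even_odd {r : ℝ} {d : ℕ} (hr : 0 < r) (hrd : r ^ d = (p : ℝ)⁻¹)
    (hd : d + 1 ≤ p) (A B : ℕ) :
    IsDominant p r 0 (He (2 * A) * derivative (He (2 * B + 1)) -
      derivative (He (2 * A)) * He (2 * B + 1)) := by
  have ha := norm_intCast_pos (p := p) (He_even_coeff_zero_ne A)
  have hb := norm_intCast_pos (p := p) (He_odd_coeff_one_ne B)
  refine isDominant_wronskian hr (mul_pos ha hb) ?_ ?_
  · have h3 : (He (2 * A)).coeff 1 = 0 := He_coeff_of_odd_add _ _ (by grind)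
    rw [coeff_wronskian]
    simp [Finset.Nat.antidiagonal_succ, h3]
  · intro i j k hk hij
    rcases Nat.even_or_odd' i with ⟨i, rfl | rfl⟩
    · rcases Nat.even_or_odd' j with ⟨j, rfl | rfl⟩
      · rw [He_coeff_of_odd_add (2 * B + 1) _ (by grind)]
        simpa using mul_pos ha hb
      · rcases Nat.eq_zero_or_pos i with rfl | hi
        · obtain ⟨e, he, hle⟩ := norm_mul_He_odd_le (p := p) B j
          refine mul_pow_lt_of_le hr hrd (mul_pos ha hb) (e := e) ?_ ?_
          · have e1 : (((2 * j + 1 : ℕ) : ℤ) - ((2 * 0 : ℕ) : ℤ)) *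
                ((He (2 * A)).coeff (2 * 0) * (He (2 * B + 1)).coeff (2 * j + 1)) =
                (He (2 * A)).coeff 0 *
                  (((2 * j + 1 : ℕ) : ℤ) * (He (2 * B + 1)).coeff (2 * j + 1)) := by
              push_cast; ring
            rw [e1, Int.cast_mul, norm_mul, mul_assoc]
            gcongr
          · have := Nat.mul_le_mul_right e (show d ≤ p - 1 by omega)
            omega
        · obtain ⟨e, he, hle⟩ := norm_He_even_le (p := p) A i
          obtain ⟨e', he', hle'⟩ := norm_He_odd_le (p := p) B j
          have := norm_index_sub_mul_le (2 * i) (2 * j + 1) hle hle'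
          rw [mul_mul_mul_comm, ← pow_add] at this
          refine mul_pow_lt_of_le hr hrd (mul_pos ha hb) this ?_
          have h1 := Nat.mul_le_mul_right e (show d ≤ p - 1 by omega)
          have h2 := Nat.mul_le_mul_right e' (show d ≤ p - 1 by omega)
          rw [mul_add]
          omega
    · rw [He_coeff_of_odd_add (2 * A) _ (by grind)]
      simpa using mul_pos ha hb

end dominant

/-- A monic polynomial with dominant constant term has no factor whose degree `d` exceeds the
degree of the part of its reduction that is prime to `X`, if the radius is `p ^ (-1 / d)`. -/
lemma not_exists_factor_of_isDominant {p : ℕ} [hp : Fact p.Prime] {F R : ℤ[X]} {c : ℤ}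
    {s t d : ℕ} {r : ℝ} (hr : 0 < r) (hrd : r ^ d = (p : ℝ)⁻¹) (hc : ¬ (p : ℤ) ∣ c)
    (hF : C c * (X ^ s * R) = F) (hR : R.Monic) (hdom : IsDominant p r s F)
    {Q : (ZMod p)[X]} (hQ0 : Q.coeff 0 ≠ 0) (hQd : Q.natDegree < d)
    (hred : (X ^ s * R).map (Int.castRingHom (ZMod p)) = X ^ t * Q) :
    ¬ ∃ g : ℤ[X], g.natDegree = d ∧ g ∣ R := by
  rintro ⟨g, hgd, h, rfl⟩
  have hcn : ‖(c : ℚ_[p])‖ = 1 := by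
    rw [Padic.norm_intCast_eq_one_iff]
    exact (((Nat.prime_iff_prime_int.1 hp.out).coprime_iff_not_dvd).2 hc).symm
  have hunit : IsUnit g.leadingCoeff := by
    have h1 : g.leadingCoeff * h.leadingCoeff = 1 := by rw [← leadingCoeff_mul]; exact hR
    exact IsUnit.of_mul_eq_one _ h1
  have hgauss : ‖(g.coeff d : ℚ_[p])‖ * r ^ d < ‖(g.coeff 0 : ℚ_[p])‖ := by
    have key := norm_coeff_mul_pow_lt_of_mul (K := ℚ_[p])
      (g := g.map (Int.castRingHom ℚ_[p])) (h := h.map (Int.castRingHom ℚ_[p])) hr (by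
        intro k hk
        have hcoeff : ∀ i, ‖(F.coeff (s + i) : ℚ_[p])‖ =
            ‖(((g * h).coeff i : ℤ) : ℚ_[p])‖ := by
          intro i
          rw [← hF, coeff_C_mul, add_comm s, coeff_X_pow_mul, Int.cast_mul, norm_mul, hcn, one_mul]
        rw [← Polynomial.map_mul, coeff_map, coeff_map, eq_intCast, eq_intCast, ← hcoeff,
          ← hcoeff]
        exact hdom k hk)
    have := key d (by omega)
    simpa only [coeff_map, eq_intCast] using this
  have hlead : ‖(g.coeff d : ℚ_[p])‖ = 1 := by
    rw [← hgd, coeff_natDegree]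
    rcases Int.isUnit_iff.1 hunit with h | h <;> simp [h]
  rw [hlead, one_mul, hrd] at hgauss
  have hndvd : ¬ (p : ℤ) ∣ g.coeff 0 := by
    intro hdvd
    have := (Padic.norm_int_le_pow_iff_dvd (p := p) (g.coeff 0) 1).2 (by simpa using hdvd)
    simp only [Nat.cast_one, zpow_neg_one] at this
    linarith
  set φ := Int.castRingHom (ZMod p)
  have hg0 : (g.map φ).coeff 0 ≠ 0 := by
    rw [coeff_map, eq_intCast]
    rwa [Ne, ZMod.intCast_zmod_eq_zero_iff_dvd]
  have hcop : IsCoprime (g.map φ) (X ^ t) := by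
    refine IsCoprime.pow_right (IsCoprime.symm ?_)
    rw [irreducible_X.coprime_iff_not_dvd, X_dvd_iff]
    exact hg0
  have hdvd : g.map φ ∣ X ^ t * Q := by
    rw [← hred]
    exact Polynomial.map_dvd φ ⟨X ^ s * h, by ring⟩
  have hQ : Q ≠ 0 := by rintro rfl; simp at hQ0
  have hle := natDegree_le_of_dvd (hcop.dvd_of_dvd_mul_left hdvd) hQ
  rw [natDegree_map_eq_of_isUnit_leadingCoeff φ hunit] at hle
  omega

lemma monic_of_C_mul_eq_wronskian {m n : ℕ} (hmn : m ≠ n) {F : ℤ[X]}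
    (hF : C ((n : ℤ) - m) * F = He m * derivative (He n) - derivative (He m) * He n) :
    F.Monic := by
  obtain ⟨-, dm⟩ := He_monic_natDegree m
  obtain ⟨-, dn⟩ := He_monic_natDegree n
  have hne : (n : ℤ) - m ≠ 0 := sub_ne_zero.2 (by exact_mod_cast hmn.symm)
  obtain ⟨N, hN⟩ : ∃ N, m + n = N + 1 := ⟨m + n - 1, by omega⟩
  have hz : ∀ i j, m + n < i + j → (He m).coeff i * (He n).coeff j = 0 := by
    intro i j hij
    rcases lt_or_ge m i with h | h
    · rw [coeff_eq_zero_of_natDegree_lt (by omega), zero_mul]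
    · rw [coeff_eq_zero_of_natDegree_lt (p := He n) (by omega), mul_zero]
  have hcoeff : F.coeff N = 1 := by
    have h1 := congrArg (fun q => q.coeff N) hF
    simp only [coeff_C_mul] at h1
    rw [coeff_wronskian, Finset.sum_eq_single (m, n)] at h1
    · simp only [He_coeff_self, mul_one] at h1
      exact mul_left_cancel₀ hne (by rw [h1, mul_one])
    · rintro ⟨i, j⟩ hx hne
      simp only [HasAntidiagonal.mem_antidiagonal, ne_eq, Prod.mk.injEq] at hx hne
      rcases lt_or_ge m i with h | h
      · rw [coeff_eq_zero_of_natDegree_lt (p := He m) (by simp; omega), zero_mul, mul_zero]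
      · rw [coeff_eq_zero_of_natDegree_lt (p := He n) (by simp; omega), mul_zero, mul_zero]
    · intro h
      simp [hN] at h
  refine monic_of_natDegree_le_of_coeff_eq_one N (natDegree_le_iff_coeff_eq_zero.2 ?_) hcoeff
  intro i hi
  have h1 := congrArg (fun q => q.coeff i) hF
  simp only [coeff_C_mul] at h1
  rw [coeff_wronskian, Finset.sum_eq_zero] at h1
  · exact (mul_eq_zero.1 h1).resolve_left hne
  · rintro ⟨a, b⟩ hx
    simp only [HasAntidiagonal.mem_antidiagonal] at hx
    rw [hz a b (by omega), mul_zero]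

lemma monic_of_X_pow_mul {F R : ℤ[X]} {s : ℕ} (hF : F.Monic) (h : F = X ^ s * R) : R.Monic :=
  (monic_X_pow s).of_mul_monic_left (h ▸ hF)

lemma dStat_eq_sum {r : ℕ} (ns : Fin r → ℕ) :
    dStat ns = ∑ i, if ns i % 2 = 1 then (1 : ℤ) else -1 := by
  simp only [dStat, Finset.card_filter, Nat.cast_sum, ← Finset.sum_sub_distrib]
  refine Finset.sum_congr rfl fun i _ => ?_
  rcases Nat.mod_two_eq_zero_or_one (ns i) with h | h <;> simp [Nat.odd_iff, Nat.even_iff, h]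

/-- Lemma `lem:scenario`.  Let `λ` be a partition with at most 2
parts and `p` a prime with `p > max{2, s_λ}` not dividing `Δ(n_λ)`.  If the reduction of
`He_λ` mod `p` is `X^t · Q` with `Q(0) ≠ 0` and `deg Q = D`, then `R_λ` has no factor in
`ℤ[X]` of degree `d` for any `D + 1 ≤ d ≤ p - s_λ - 1`. -/
theorem stmt10 (r : ℕ) (hr : r ≤ 2) (lam : Fin r → ℕ) (hanti : Antitone lam)
    (p : ℕ) (hp : p.Prime) (hps : 2 ⊔ sStat (degSeq lam) < p)
    (hpd : ¬ (p : ℤ) ∣ vand (degSeq lam))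
    (HeL RL : Polynomial ℤ)
    (hHe : Polynomial.C (vand (degSeq lam)) * HeL = wronskHe (degSeq lam))
    (hRdec : HeL = Polynomial.X ^ sStat (degSeq lam) * RL)
    (hR0 : RL.coeff 0 ≠ 0)
    (t D : ℕ) (Q : Polynomial (ZMod p))
    (hQ0 : Q.coeff 0 ≠ 0) (hQD : Q.natDegree = D)
    (hred : HeL.map (Int.castRingHom (ZMod p)) = Polynomial.X ^ t * Q) :
    ∀ d : ℕ, D + 1 ≤ d → d ≤ p - sStat (degSeq lam) - 1 →
      ¬ ∃ g : Polynomial ℤ, g.natDegree = d ∧ g ∣ RL := by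
  intro d hd1 hd2
  have : Fact p.Prime := ⟨hp⟩
  have hp0 : (0 : ℝ) < p := by exact_mod_cast hp.pos
  obtain ⟨r₀, hr₀, hrd⟩ : ∃ r : ℝ, 0 < r ∧ r ^ d = (p : ℝ)⁻¹ :=
    ⟨((p : ℝ)⁻¹) ^ (d⁻¹ : ℝ), by positivity, Real.rpow_inv_natCast_pow (by positivity) (by omega)⟩
  have hps2 : 2 < p := lt_of_le_of_lt le_sup_left hps
  have hpss : sStat (degSeq lam) < p := lt_of_le_of_lt le_sup_right hps
  suffices HeL.Monic ∧ IsDominant p r₀ (sStat (degSeq lam)) (wronskHe (degSeq lam)) from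
    not_exists_factor_of_isDominant hr₀ hrd hpd (by rw [← hRdec, hHe])
      (monic_of_X_pow_mul this.1 hRdec) this.2 hQ0 (by omega) (by rw [← hRdec, hred])
  generalize degSeq lam = ns at *
  interval_cases r
  · have hW : wronskHe ns = 1 := by simp [wronskHe]
    have hs : sStat ns = 0 := by simp [sStat, dStat]
    have hv : vand ns = 1 := by simp [vand]
    have hHe1 : HeL = 1 := by simpa [hW, hv] using hHe
    refine ⟨hHe1 ▸ monic_one, fun k hk => ?_⟩
    have : k ≠ 0 := by omega
    simp [hW, hs, coeff_one, this]
  · have hW : wronskHe ns = He (ns 0) := by simp [wronskHe]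
    have hv : vand ns = 1 := by
      have h0 : Finset.Iio (0 : Fin 1) = ∅ := by decide
      simp [vand, h0]
    have hHe1 : HeL = He (ns 0) := by simpa [hW, hv] using hHe
    refine ⟨hHe1 ▸ (He_monic_natDegree _).1, ?_⟩
    rw [hW]
    rcases Nat.even_or_odd' (ns 0) with ⟨M, hM | hM⟩
    · have hs : sStat ns = 0 := by
        simp [sStat, dStat_eq_sum, hM]
      rw [hs] at hd2 ⊢
      rw [hM]
      exact isDominant_He_even hr₀ hrd (by omega) M
    · have hs : sStat ns = 1 := by
        simp [sStat, dStat_eq_sum, hM]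
      rw [hs] at hd2 ⊢
      rw [hM]
      exact isDominant_He_odd hr₀ hrd (by omega) M
  · have hW : wronskHe ns =
        He (ns 0) * derivative (He (ns 1)) - derivative (He (ns 0)) * He (ns 1) := by
      simp [wronskHe, Matrix.det_fin_two]
      ring
    have hv : vand ns = (ns 1 : ℤ) - ns 0 := by
      have h0 : Finset.Iio (0 : Fin 2) = ∅ := by decide
      have h1 : Finset.Iio (1 : Fin 2) = {0} := by decide
      simp [vand, Fin.prod_univ_two, h0, h1]
    rw [hW, hv] at hHe
    rw [hv] at hpd
    refine ⟨monic_of_C_mul_eq_wronskian (fun h => hpd (by simp [h])) hHe, ?_⟩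
    rw [hW]
    rcases Nat.even_or_odd' (ns 0) with ⟨A, hA | hA⟩ <;>
    rcases Nat.even_or_odd' (ns 1) with ⟨B, hB | hB⟩
    · have hs : sStat ns = 1 := by
        simp [sStat, dStat_eq_sum, Fin.sum_univ_two, hA, hB]
      rw [hs] at hd2 ⊢
      rw [hA, hB] at hpd ⊢
      exact isDominant_wronskian_even_even hr₀ hrd (by omega) hpd
    · have hs : sStat ns = 0 := by
        simp [sStat, dStat_eq_sum, Fin.sum_univ_two, hA, hB, Nat.add_mod]
      rw [hs] at hd2 ⊢
      rw [hA, hB]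
      exact isDominant_wronskian_even_odd hr₀ hrd (by omega) A B
    · have hs : sStat ns = 0 := by
        simp [sStat, dStat_eq_sum, Fin.sum_univ_two, hA, hB, Nat.add_mod]
      rw [hs] at hd2 ⊢
      rw [hA, hB]
      refine IsDominant.of_neg ?_
      have := isDominant_wronskian_even_odd hr₀ hrd (by omega) B A
      convert this using 1
      ring
    · have hs : sStat ns = 3 := by
        simp [sStat, dStat_eq_sum, Fin.sum_univ_two, hA, hB, Nat.add_mod]
      rw [hs] at hd2 hpss ⊢
      rw [hA, hB] at hpd ⊢
      exact isDominant_wronskian_odd_odd hr₀ hrd (by omega) (by omega) hpd
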